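/- arXiv:2110.08686 — 2 statements merged into one kernel-verified Lean document; each statement's English description precedes it below -/
import Mathlib

section
/- Let S : ℝ ⇒ ℝⁿ be a smooth sweeping process, let t ∈ dom(S) with t < sup(dom(S)), and let x ∈ S(t) be such that ‖D*S(t,x)|⁺ < +∞. Then the oriented calm graphical modulus of S at t for x equals the asymmetric modulus of the coderivative: calm↑S(t,x) = ‖D*S(t,x)|⁺. -/
open Set Metric Filter MeasureTheory
open scoped ENNReal RealInnerProductSpace Topology Pointwise

section Preliminaries

variable {E : Type*} [NormedAddCommGroup E] [InnerProductSpace ℝ E]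

/-- The graph `𝒮 = {(t,x) : x ∈ S t}` of a multivalued map `S : ℝ ⇒ E`. -/
def sgraph (S : ℝ → Set E) : Set (ℝ × E) := {p | p.2 ∈ S p.1}

/-- The effective domain of a multivalued map. -/
def sdom (S : ℝ → Set E) : Set ℝ := {t | (S t).Nonempty}

/-- The euclidean pairing on `ℝ × E`. -/
def pinner (p q : ℝ × E) : ℝ := p.1 * q.1 + ⟪p.2, q.2⟫

/-- Fréchet normal cone of a set `C ⊆ E` at `x`. -/
def frechetNC (C : Set E) (x : E) : Set E :=
  {v | ∀ ε : ℝ, 0 < ε → ∃ δ : ℝ, 0 < δ ∧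
    ∀ y ∈ C, ‖y - x‖ < δ → ⟪v, y - x⟫ ≤ ε * ‖y - x‖}

/-- Limiting (Mordukhovich) normal cone of a set `C ⊆ E` at `x`. -/
def limitingNC (C : Set E) (x : E) : Set E :=
  {v | ∃ xs vs : ℕ → E, (∀ i, xs i ∈ C) ∧ (∀ i, vs i ∈ frechetNC C (xs i)) ∧
    Tendsto xs atTop (𝓝 x) ∧ Tendsto vs atTop (𝓝 v)}

/-- Fréchet normal cone of a set `C ⊆ ℝ × E` at `z` (w.r.t. the euclidean pairing). -/
def frechetNCP (C : Set (ℝ × E)) (z : ℝ × E) : Set (ℝ × E) :=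
  {v | ∀ ε : ℝ, 0 < ε → ∃ δ : ℝ, 0 < δ ∧
    ∀ y ∈ C, ‖y - z‖ < δ → pinner v (y - z) ≤ ε * ‖y - z‖}

/-- Limiting normal cone of a set `C ⊆ ℝ × E` at `z`. -/
def limitingNCP (C : Set (ℝ × E)) (z : ℝ × E) : Set (ℝ × E) :=
  {v | ∃ zs vs : ℕ → ℝ × E, (∀ i, zs i ∈ C) ∧ (∀ i, vs i ∈ frechetNCP C (zs i)) ∧
    Tendsto zs atTop (𝓝 z) ∧ Tendsto vs atTop (𝓝 v)}

/-- The (limiting) coderivative `D*S(t,x)(u) = {a : (a,-u) ∈ N_𝒮(t,x)}`. -/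
def coderiv (S : ℝ → Set E) (t : ℝ) (x : E) (u : E) : Set ℝ :=
  {a | (a, -u) ∈ limitingNCP (sgraph S) (t, x)}

/-- Asymmetric (oriented) modulus `‖D*S(t,x)|⁺ = sup {a⁺ : a ∈ D*S(t,x)(u), ‖u‖ ≤ 1}`
(with `sup ∅ = 0`). -/
noncomputable def asymMod (S : ℝ → Set E) (t : ℝ) (x : E) : ℝ≥0∞ :=
  ⨆ (u : E) (_ : ‖u‖ ≤ 1) (a : ℝ) (_ : a ∈ coderiv S t x u), ENNReal.ofReal a

/-- Modulus `‖D*S(t,x)‖⁺ = sup {|a| : a ∈ D*S(t,x)(u), ‖u‖ ≤ 1}` (with `sup ∅ = 0`). -/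
noncomputable def symMod (S : ℝ → Set E) (t : ℝ) (x : E) : ℝ≥0∞ :=
  ⨆ (u : E) (_ : ‖u‖ ≤ 1) (a : ℝ) (_ : a ∈ coderiv S t x u), ENNReal.ofReal |a|

/-- Oriented talweg function `φ↑(t) = sup_{x ∈ S(t)} ‖D*S(t,x)|⁺`. -/
noncomputable def orientedTalweg (S : ℝ → Set E) (t : ℝ) : ℝ≥0∞ :=
  ⨆ x ∈ S t, asymMod S t x

/-- Talweg function `φ(t) = sup_{x ∈ S(t)} ‖D*S(t,x)‖⁺`. -/
noncomputable def talweg (S : ℝ → Set E) (t : ℝ) : ℝ≥0∞ :=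
  ⨆ x ∈ S t, symMod S t x

/-- `M` is a `C¹`-submanifold of codimension `c` of `ℝ × E`: locally it is the zero set
of a `C¹` submersion into `ℝ^c`. -/
def IsC1SubmanifoldCodim (c : ℕ) (M : Set (ℝ × E)) : Prop :=
  ∀ z ∈ M, ∃ U : Set (ℝ × E), IsOpen U ∧ z ∈ U ∧
    ∃ f : ℝ × E → EuclideanSpace ℝ (Fin c),
      ContDiffOn ℝ 1 f U ∧ (∀ y ∈ U, Function.Surjective ⇑(fderivWithin ℝ f U y)) ∧
      M ∩ U = {y ∈ U | f y = 0}

/-- Smooth sweeping process: the graph `𝒮` is closed, connected, and either a `C¹`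
submanifold of dimension at most `dim E` (i.e. codimension at least one), or a
full-dimensional manifold with boundary whose boundary `∂𝒮` (the topological frontier)
is a `C¹` submanifold of codimension one. -/
def SmoothSweepingProcess (S : ℝ → Set E) : Prop :=
  IsClosed (sgraph S) ∧ IsConnected (sgraph S) ∧
    ((∃ c : ℕ, 1 ≤ c ∧ IsC1SubmanifoldCodim c (sgraph S)) ∨
      (sgraph S = closure (interior (sgraph S)) ∧
        IsC1SubmanifoldCodim 1 (frontier (sgraph S))))

/-- The map `H_S(t) = ∂𝒮 ∩ ({t} × E)`. -/
def HSmap (S : ℝ → Set E) (t : ℝ) : Set (ℝ × E) :=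
  frontier (sgraph S) ∩ {p : ℝ × E | p.1 = t}

/-- Continuity at `t₀` (relative to `I`) of a set-valued map for the Hausdorff–Pompeiu
metric. -/
def HPContinuousAt {X : Type*} [PseudoEMetricSpace X] (F : ℝ → Set X) (I : Set ℝ)
    (t₀ : ℝ) : Prop :=
  ∀ ε : ℝ, 0 < ε → ∃ δ : ℝ, 0 < δ ∧ ∀ t ∈ I, |t - t₀| < δ →
    EMetric.hausdorffEdist (F t) (F t₀) < ENNReal.ofReal ε

/-- Continuity on `I` of a set-valued map for the Hausdorff–Pompeiu metric. -/
def HPContinuousOn {X : Type*} [PseudoEMetricSpace X] (F : ℝ → Set X) (I : Set ℝ) : Prop :=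
  ∀ t₀ ∈ I, HPContinuousAt F I t₀

/-- `γ` is absolutely continuous on `J` (with some integrable a.e. derivative). -/
def AbsContOn (γ : ℝ → E) (J : Set ℝ) : Prop :=
  ∃ g : ℝ → E, IntegrableOn g J ∧ ∀ s ∈ J, ∀ t ∈ J, γ t - γ s = ∫ u in s..t, g u

/-- `γ` is piecewise absolutely continuous on `I`: its discontinuities are contained in a
closed countable set `D`, and `γ` is absolutely continuous on each connected component of
`I \ D`. -/
def PiecewiseAC (γ : ℝ → E) (I : Set ℝ) : Prop :=
  ∃ D : Set ℝ, IsClosed D ∧ D.Countable ∧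
    ∀ t ∈ I \ D, AbsContOn γ (connectedComponentIn (I \ D) t)

/-- `γ` (an absolutely continuous curve, with a.e. derivative `γ'`) is an orbit of the
sweeping process defined by `S` on the interval `I`:  `γ(t) ∈ S(t)` on `I` and
`-γ̇(t) ∈ N_{S(t)}(γ(t))` for a.e. `t ∈ I`. -/
def ACOrbit (S : ℝ → Set E) (I : Set ℝ) (γ γ' : ℝ → E) : Prop :=
  (∀ t ∈ I, γ t ∈ S t) ∧ IntegrableOn γ' I ∧
    (∀ s ∈ I, ∀ t ∈ I, γ t - γ s = ∫ u in s..t, γ' u) ∧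
    (∀ᵐ t ∂(volume.restrict I), -γ' t ∈ limitingNC (S t) (γ t))

/-- `γ` (with a.e. derivative `γ'`) is a piecewise absolutely continuous orbit of the
sweeping process defined by `S` on `I`. -/
def PACOrbit (S : ℝ → Set E) (I : Set ℝ) (γ γ' : ℝ → E) : Prop :=
  ∃ D : Set ℝ, IsClosed D ∧ D.Countable ∧
    ∀ t ∈ I \ D, ACOrbit S (connectedComponentIn (I \ D) t) γ γ'

/-- Assumption (A1): from every point `(t,x) ∈ 𝒮` with `‖D*S(t,x)|⁺ < ∞` there issues an
orbit of the sweeping process. -/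
def AssumptionA1 (S : ℝ → Set E) : Prop :=
  ∀ t : ℝ, ∀ x ∈ S t, asymMod S t x < ⊤ →
    ∃ δ : ℝ, 0 < δ ∧ ∃ γ γ' : ℝ → E, ACOrbit S (Ico t (t + δ)) γ γ' ∧ γ t = x

/-- Assumption (A2) at `tb`: the oriented talweg is finite just to the right of `tb`. -/
def AssumptionA2At (S : ℝ → Set E) (tb : ℝ) : Prop :=
  ∃ δ : ℝ, 0 < δ ∧ ∀ t ∈ Ioo tb (tb + δ), orientedTalweg S t < ⊤

/-- Assumption (A3) at `tb`: `H_S` is Hausdorff–Pompeiu continuous just to the right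
of `tb`. -/
def AssumptionA3At (S : ℝ → Set E) (tb : ℝ) : Prop :=
  ∃ δ : ℝ, 0 < δ ∧ HPContinuousOn (HSmap S) (Ioo tb (tb + δ))

/-- The set `𝒯` of points of the domain at which (A2) and (A3) hold. -/
def goodSet (S : ℝ → Set E) : Set ℝ :=
  {t | t ∈ sdom S ∧ AssumptionA2At S t ∧ AssumptionA3At S t}

/-- `S` has bounded values. -/
def BoundedValues (S : ℝ → Set E) : Prop := ∀ t, Bornology.IsBounded (S t)

/-- A catching-up sequence `{(tᵢ,xᵢ)}_{i ≥ 0}` for `S`. -/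
def CatchingUp (S : ℝ → Set E) (t : ℕ → ℝ) (x : ℕ → E) : Prop :=
  StrictMono t ∧ (∀ i, x i ∈ S (t i)) ∧
    ∀ i, dist (x i) (x (i + 1)) = infDist (x i) (S (t (i + 1)))

/-- A finite catching-up sequence `{(tᵢ,xᵢ)}_{i=0}^k` for `S`. -/
def FiniteCatchingUp (S : ℝ → Set E) (k : ℕ) (t : ℕ → ℝ) (x : ℕ → E) : Prop :=
  (∀ i < k, t i < t (i + 1)) ∧ (∀ i ≤ k, x i ∈ S (t i)) ∧
    ∀ i < k, dist (x i) (x (i + 1)) = infDist (x i) (S (t (i + 1)))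

/-- A piecewise catching-up sequence for `S`: blocks `{(tʲᵢ,Yʲᵢ)}_{i=0}^{k_j}`, each a
catching-up sequence, with `tʲ_{k_j} = tʲ⁺¹₀`. -/
def PiecewiseCatchingUp (S : ℝ → Set E) (k : ℕ → ℕ) (t : ℕ → ℕ → ℝ) (Y : ℕ → ℕ → E) : Prop :=
  (∀ j, FiniteCatchingUp S (k j) (t j) (Y j)) ∧ ∀ j, t j (k j) = t (j + 1) 0

/-- Outer semicontinuity of `S` at `tb`. -/
def OuterSemicontinuousAt (S : ℝ → Set E) (tb : ℝ) : Prop :=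
  ∀ (tk : ℕ → ℝ) (xk : ℕ → E) (x : E), (∀ k, xk k ∈ S (tk k)) →
    Tendsto tk atTop (𝓝 tb) → Tendsto xk atTop (𝓝 x) → x ∈ S tb

/-- Inner semicontinuity of `S` at `tb`. -/
def InnerSemicontinuousAt (S : ℝ → Set E) (tb : ℝ) : Prop :=
  ∀ x ∈ S tb, ∀ tk : ℕ → ℝ, (∀ k, tk k ∈ sdom S) → Tendsto tk atTop (𝓝 tb) →
    Tendsto (fun k => infDist x (S (tk k))) atTop (𝓝 0)

/-- The oriented calm graphical modulus `calm↑S(t,x)`. -/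
noncomputable def calmUp (S : ℝ → Set E) (t : ℝ) (x : E) : ℝ :=
  sInf {κ : ℝ | 0 < κ ∧ ∃ ε : ℝ, 0 < ε ∧ ∃ δ : ℝ, 0 < δ ∧
    ∀ t₁ ∈ Ioo t (t + ε), S t ∩ ball x δ ⊆ S t₁ + ball (0 : E) (κ * (t₁ - t))}

section Helpers

variable {E : Type*} [NormedAddCommGroup E] [InnerProductSpace ℝ E]

/-- Pairing with `v` as a continuous linear functional. -/
noncomputable def plin (v : ℝ × E) : ℝ × E →L[ℝ] ℝ :=
  (v.1 • ContinuousLinearMap.fst ℝ ℝ E) + (innerSL ℝ v.2).comp (ContinuousLinearMap.snd ℝ ℝ E)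

lemma plin_apply (v q : ℝ × E) : plin v q = pinner v q := by
  simp [plin, pinner]

lemma pinner_le (v q : ℝ × E) : pinner v q ≤ 2 * ‖v‖ * ‖q‖ := by
  have h1 : v.1 * q.1 ≤ ‖v‖ * ‖q‖ := by
    calc v.1 * q.1 ≤ |v.1 * q.1| := le_abs_self _
      _ = ‖v.1‖ * ‖q.1‖ := by rw [abs_mul]; rfl
      _ ≤ _ := by gcongr; exacts [norm_fst_le v, norm_fst_le q]
  have h2 : ⟪v.2, q.2⟫ ≤ ‖v‖ * ‖q‖ := by
    calc ⟪v.2, q.2⟫ ≤ ‖v.2‖ * ‖q.2‖ := real_inner_le_norm _ _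
      _ ≤ _ := by gcongr; exacts [norm_snd_le v, norm_snd_le q]
  unfold pinner
  linarith

/-- Strong (slice-wise) Clarke tangency. -/
def STan (C : Set (ℝ × E)) (z h : ℝ × E) : Prop :=
  ∀ ε : ℝ, 0 < ε → ∃ δ : ℝ, 0 < δ ∧ ∀ z' ∈ C, ‖z' - z‖ < δ → ∀ s : ℝ, 0 < s → s < δ →
    ∃ y : E, (z'.1 + s * h.1, y) ∈ C ∧ ‖y - z'.2 - s • h.2‖ ≤ ε * s

lemma STan.frechet_le {C : Set (ℝ × E)} {z h : ℝ × E} (H : STan C z h) {ε : ℝ} (hε : 0 < ε) :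
    ∃ δ : ℝ, 0 < δ ∧ ∀ z' ∈ C, ‖z' - z‖ < δ → ∀ v ∈ frechetNCP C z',
      pinner v h ≤ 2 * ‖v‖ * ε + ε * (‖h‖ + ε) := by
  obtain ⟨δ, hδ, H⟩ := H ε hε
  refine ⟨δ, hδ, fun z' hz' hz'' v hv => ?_⟩
  obtain ⟨η, hη, hv⟩ := hv ε hε
  have hK : 0 < ‖h‖ + ε := by positivity
  set s := min (δ / 2) (η / (2 * (‖h‖ + ε))) with hs
  have hs0 : 0 < s := by rw [hs]; positivity
  have hsδ : s < δ := lt_of_le_of_lt (min_le_left _ _) (by linarith)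
  obtain ⟨y, hy, hyn⟩ := H z' hz' hz'' s hs0 hsδ
  set d : ℝ × E := (0, y - z'.2 - s • h.2) with hd
  have hdn : ‖d‖ ≤ ε * s := by
    rw [hd, Prod.norm_def]; simp only [norm_zero]
    exact max_le (by positivity) hyn
  have heq : ((z'.1 + s * h.1, y) : ℝ × E) - z' = s • h + d := by
    ext <;> simp [hd]
  have hn : ‖s • h + d‖ ≤ s * (‖h‖ + ε) := by
    calc _ ≤ ‖s • h‖ + ‖d‖ := norm_add_le _ _
      _ ≤ s * ‖h‖ + ε * s := by rw [norm_smul, Real.norm_of_nonneg hs0.le]; linarith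
      _ = _ := by ring
  have hsη : s * (‖h‖ + ε) < η := by
    have : s ≤ η / (2 * (‖h‖ + ε)) := min_le_right _ _
    rw [le_div_iff₀ (by positivity)] at this
    linarith
  have h1 := hv _ hy (by rw [heq]; exact lt_of_le_of_lt hn hsη)
  rw [heq] at h1
  have h2 : pinner v (s • h + d) = s * pinner v h - pinner v (-d) := by
    simp only [← plin_apply]; simp
  have h3 := pinner_le v (-d)
  rw [norm_neg] at h3
  have h4 : 2 * ‖v‖ * ‖d‖ ≤ 2 * ‖v‖ * (ε * s) := by gcongr
  have h5 : ε * ‖s • h + d‖ ≤ ε * (s * (‖h‖ + ε)) := by gcongr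
  have h6 : s * pinner v h ≤ s * (2 * ‖v‖ * ε + ε * (‖h‖ + ε)) := by linarith
  exact le_of_mul_le_mul_left h6 hs0

lemma STan.limiting_le {C : Set (ℝ × E)} {z h : ℝ × E} (H : STan C z h) {v : ℝ × E}
    (hv : v ∈ limitingNCP C z) : pinner v h ≤ 0 := by
  obtain ⟨zs, vs, hzC, hvs, hz, hvt⟩ := hv
  have key : ∀ ε : ℝ, 0 < ε → pinner v h ≤ 2 * ‖v‖ * ε + ε * (‖h‖ + ε) := by
    intro ε hε
    obtain ⟨δ, hδ, K⟩ := H.frechet_le hε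
    have hc1 : Continuous fun w : ℝ × E => pinner w h := by unfold pinner; fun_prop
    have hc2 : Continuous fun w : ℝ × E => 2 * ‖w‖ * ε + ε * (‖h‖ + ε) := by fun_prop
    refine le_of_tendsto_of_tendsto ((hc1.tendsto v).comp hvt) ((hc2.tendsto v).comp hvt) ?_
    filter_upwards [hz (Metric.ball_mem_nhds z hδ)] with i hi
    exact K (zs i) (hzC i) (by simpa [dist_eq_norm] using hi) (vs i) (hvs i)
  have hc : Continuous fun ε : ℝ => 2 * ‖v‖ * ε + ε * (‖h‖ + ε) := by fun_prop
  have ht : Tendsto (fun ε : ℝ => 2 * ‖v‖ * ε + ε * (‖h‖ + ε)) (𝓝[>] 0) (𝓝 0) := by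
    have := (hc.tendsto 0).mono_left (nhdsWithin_le_nhds (s := Ioi 0))
    simpa using this
  refine ge_of_tendsto ht ?_
  filter_upwards [self_mem_nhdsWithin] with ε hε
  exact key ε hε

/-- The set of admissible constants in the definition of `calmUp`. -/
def calmSet (S : ℝ → Set E) (t : ℝ) (x : E) : Set ℝ :=
  {κ : ℝ | 0 < κ ∧ ∃ ε : ℝ, 0 < ε ∧ ∃ δ : ℝ, 0 < δ ∧
    ∀ t₁ ∈ Ioo t (t + ε), S t ∩ ball x δ ⊆ S t₁ + ball (0 : E) (κ * (t₁ - t))}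

lemma calm_of_STan {S : ℝ → Set E} {t : ℝ} {x w : E} (H : STan (sgraph S) (t, x) (1, w))
    {κ : ℝ} (hκ : ‖w‖ < κ) : κ ∈ calmSet S t x := by
  have hκ0 : 0 < κ := lt_of_le_of_lt (norm_nonneg _) hκ
  obtain ⟨δ, hδ, H⟩ := H ((κ - ‖w‖) / 2) (by linarith)
  refine ⟨hκ0, δ, hδ, δ, hδ, fun t₁ ht₁ y hy => ?_⟩
  have hs : 0 < t₁ - t := by linarith [ht₁.1]
  obtain ⟨y₁, hy₁, hn⟩ := H (t, y) hy.1 (by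
    have := hy.2
    rw [mem_ball, dist_eq_norm] at this
    simpa [Prod.norm_def, hδ] using this) (t₁ - t) hs (by linarith [ht₁.2])
  have hy₁' : y₁ ∈ S t₁ := by
    have : t + (t₁ - t) * 1 = t₁ := by ring
    simpa [sgraph, this] using hy₁
  refine Set.mem_add.2 ⟨y₁, hy₁', y - y₁, ?_, by abel⟩
  rw [mem_ball_zero_iff]
  have e : y - y₁ = -(y₁ - y - (t₁ - t) • w) - (t₁ - t) • w := by abel
  calc ‖y - y₁‖ ≤ ‖y₁ - y - (t₁ - t) • w‖ + ‖(t₁ - t) • w‖ := by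
        rw [e]; refine (norm_sub_le _ _).trans ?_; rw [norm_neg]
    _ ≤ (κ - ‖w‖) / 2 * (t₁ - t) + (t₁ - t) * ‖w‖ := by
        rw [norm_smul, Real.norm_of_nonneg hs.le]; gcongr
    _ < κ * (t₁ - t) := by nlinarith

lemma le_of_calm {S : ℝ → Set E} {t : ℝ} {x u : E} {a κ : ℝ} (hx : x ∈ S t)
    (ha : (a, -u) ∈ frechetNCP (sgraph S) (t, x)) (hu : ‖u‖ ≤ 1) (hκ : κ ∈ calmSet S t x) :
    a ≤ κ := by
  obtain ⟨hκ0, ε, hε, δ, hδ, H⟩ := hκ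
  have key : ∀ r : ℝ, 0 < r → a ≤ κ + r * (1 + κ) := by
    intro r hr
    obtain ⟨η, hη, ha⟩ := ha r hr
    set s := min (ε / 2) (η / (2 * (1 + κ))) with hs
    have hs0 : 0 < s := by rw [hs]; positivity
    have hsε : s < ε := lt_of_le_of_lt (min_le_left _ _) (by linarith)
    have hsη : s * (1 + κ) < η := by
      have : s ≤ η / (2 * (1 + κ)) := min_le_right _ _
      rw [le_div_iff₀ (by positivity)] at this
      linarith
    obtain ⟨y, hy, b, hb, hyb⟩ := Set.mem_add.1
      (H (t + s) ⟨by linarith, by linarith⟩ ⟨hx, mem_ball_self hδ⟩)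
    rw [mem_ball_zero_iff] at hb
    have hb' : ‖b‖ ≤ κ * s := by
      have : t + s - t = s := by ring
      rw [this] at hb; exact hb.le
    have e : ((t + s, y) : ℝ × E) - (t, x) = (s, -b) := by
      rw [← hyb]; ext <;> simp
    have hn : ‖((s, -b) : ℝ × E)‖ ≤ s * (1 + κ) := by
      rw [Prod.norm_def]; simp only [norm_neg, Real.norm_of_nonneg hs0.le]
      exact max_le (by nlinarith) (by nlinarith)
    have h1 := ha (t + s, y) hy (by rw [e]; exact lt_of_le_of_lt hn hsη)
    rw [e] at h1
    have h2 : pinner (a, -u) (s, -b) = a * s + ⟪u, b⟫ := by simp [pinner]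
    have h3 : -⟪u, b⟫ ≤ κ * s := by
      have h := abs_real_inner_le_norm u b
      have h' := neg_le_abs ⟪u, b⟫
      nlinarith [norm_nonneg b]
    have h4 : r * ‖((s, -b) : ℝ × E)‖ ≤ r * (s * (1 + κ)) := by gcongr
    have h5 : s * a ≤ s * (κ + r * (1 + κ)) := by linarith
    exact le_of_mul_le_mul_left h5 hs0
  by_contra! hlt
  have := key ((a - κ) / (2 * (1 + κ))) (div_pos (by linarith) (by positivity))
  have e : (a - κ) / (2 * (1 + κ)) * (1 + κ) = (a - κ) / 2 := by field_simp
  rw [e] at this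
  linarith

lemma frechet_sub_limiting {C : Set (ℝ × E)} {z v : ℝ × E} (hz : z ∈ C)
    (hv : v ∈ frechetNCP C z) : v ∈ limitingNCP C z :=
  ⟨fun _ => z, fun _ => v, fun _ => hz, fun _ => hv, tendsto_const_nhds, tendsto_const_nhds⟩

lemma frechet_smul {C : Set (ℝ × E)} {z v : ℝ × E} {r : ℝ} (hr : 0 < r)
    (hv : v ∈ frechetNCP C z) : r • v ∈ frechetNCP C z := by
  intro ε hε
  obtain ⟨δ, hδ, h⟩ := hv (ε / r) (by positivity)
  refine ⟨δ, hδ, fun y hy hyn => ?_⟩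
  have h1 := h y hy hyn
  have e : pinner (r • v) (y - z) = r * pinner v (y - z) := by
    simp [pinner, inner_smul_left]; ring
  rw [e]
  calc _ ≤ r * (ε / r * ‖y - z‖) := by gcongr
    _ = _ := by field_simp

lemma ofReal_le_asymMod {S : ℝ → Set E} {t : ℝ} {x u : E} {a : ℝ} (hx : x ∈ S t)
    (ha : (a, -u) ∈ frechetNCP (sgraph S) (t, x)) (hu : ‖u‖ ≤ 1) :
    ENNReal.ofReal a ≤ asymMod S t x := by
  unfold asymMod
  exact le_iSup₂_of_le u hu (le_iSup₂_of_le a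
    (frechet_sub_limiting (C := sgraph S) (z := (t, x)) hx ha) le_rfl)

lemma le_asymMod_toReal {S : ℝ → Set E} {t : ℝ} {x u : E} {a : ℝ} (hx : x ∈ S t)
    (hfin : asymMod S t x < ⊤)
    (ha : (a, -u) ∈ frechetNCP (sgraph S) (t, x)) (hu : ‖u‖ ≤ 1) :
    a ≤ (asymMod S t x).toReal :=
  (ENNReal.ofReal_le_iff_le_toReal hfin.ne).1 (ofReal_le_asymMod hx ha hu)

lemma time_le_zero {S : ℝ → Set E} {t : ℝ} {x : E} {a : ℝ} (hx : x ∈ S t)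
    (hfin : asymMod S t x < ⊤)
    (ha : (a, (0 : E)) ∈ frechetNCP (sgraph S) (t, x)) : a ≤ 0 := by
  by_contra! h
  set A := (asymMod S t x).toReal with hA
  have hA0 : 0 ≤ A := ENNReal.toReal_nonneg
  have h1 := frechet_smul (r := (A + 1) / a) (by positivity) ha
  have h2 : ((A + 1) / a) • ((a, 0) : ℝ × E) = (A + 1, -(0 : E)) := by
    ext <;> simp; field_simp
  rw [h2] at h1
  have := le_asymMod_toReal hx hfin h1 (by simp)
  linarith

/-- Reduction of the theorem to normal regularity and tangency. -/
lemma main_reduction {S : ℝ → Set E} {t : ℝ} {x : E} (hx : x ∈ S t)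
    (hfin : asymMod S t x < ⊤)
    (h1 : ∀ v ∈ limitingNCP (sgraph S) (t, x), v ∈ frechetNCP (sgraph S) (t, x))
    (h2 : ∀ κ : ℝ, (asymMod S t x).toReal < κ →
      ∃ w : E, ‖w‖ < κ ∧ STan (sgraph S) (t, x) (1, w)) :
    calmUp S t x = (asymMod S t x).toReal := by
  change sInf (calmSet S t x) = _
  have hmem : ∀ κ : ℝ, (asymMod S t x).toReal < κ → κ ∈ calmSet S t x := by
    intro κ hκ
    obtain ⟨w, hw, H⟩ := h2 κ hκ
    exact calm_of_STan H hw
  have hbdd : BddBelow (calmSet S t x) := ⟨0, fun κ hκ => hκ.1.le⟩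
  apply le_antisymm
  · refine le_of_forall_gt_imp_ge_of_dense fun κ hκ => csInf_le hbdd (hmem κ hκ)
  · refine le_csInf ⟨_, hmem _ (lt_add_one _)⟩ fun κ hκ => ?_
    refine ENNReal.toReal_le_of_le_ofReal hκ.1.le ?_
    unfold asymMod
    refine iSup₂_le fun u hu => iSup₂_le fun a ha => ?_
    exact ENNReal.ofReal_le_ofReal (le_of_calm hx (h1 _ ha) hu hκ)

lemma strict_bound {P F : Type*} [NormedAddCommGroup P] [NormedSpace ℝ P]
    [NormedAddCommGroup F] [NormedSpace ℝ F] {f : P → F} {L : P →L[ℝ] F} {z : P}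
    (hf : HasStrictFDerivAt f L z) {c : ℝ} (hc : 0 < c) :
    ∃ δ : ℝ, 0 < δ ∧ ∀ p, ‖p - z‖ < δ → ∀ q, ‖q - z‖ < δ →
      ‖f p - f q - L (p - q)‖ ≤ c * ‖p - q‖ := by
  obtain ⟨s, hs, h⟩ := hf.approximates_deriv_on_nhds (c := ⟨c, hc.le⟩) (Or.inr hc)
  obtain ⟨δ, hδ, hsub⟩ := Metric.mem_nhds_iff.1 hs
  exact ⟨δ, hδ, fun p hp q hq => h p (hsub (by simpa [dist_eq_norm] using hp)) q
    (hsub (by simpa [dist_eq_norm] using hq))⟩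

lemma strict_decrease {P : Type*} [NormedAddCommGroup P] [NormedSpace ℝ P]
    {f : P → ℝ} {L : P →L[ℝ] ℝ} {z h : P} (hf : HasStrictFDerivAt f L z) (hL : L h < 0) :
    ∃ δ : ℝ, 0 < δ ∧ ∀ q, ‖q - z‖ < δ → ∀ s : ℝ, 0 < s → s < δ → f (q + s • h) < f q := by
  have hc : 0 < (-L h) / (2 * (‖h‖ + 1)) := div_pos (by linarith) (by positivity)
  obtain ⟨δ, hδ, H⟩ := strict_bound hf hc
  refine ⟨δ / (2 * (‖h‖ + 1)), by positivity, fun q hq s hs hsd => ?_⟩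
  have hsd' : s * (‖h‖ + 1) < δ / 2 := by
    rw [lt_div_iff₀ (by positivity)] at hsd ⊢; linarith
  have hq' : ‖q - z‖ < δ / 2 := by
    refine hq.trans_le ?_
    gcongr
    have := norm_nonneg h
    linarith
  have hsh : ‖s • h‖ = s * ‖h‖ := by rw [norm_smul, Real.norm_of_nonneg hs.le]
  have h1 := H (q + s • h) (by
    have : q + s • h - z = (q - z) + s • h := by abel
    rw [this]
    refine (norm_add_le _ _).trans_lt ?_
    rw [hsh]; linarith) q (by linarith)
  have e : q + s • h - q = s • h := by abel
  rw [e, hsh, map_smul, smul_eq_mul] at h1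
  have h2 := (le_abs_self _).trans h1
  have h3 : (-L h) / (2 * (‖h‖ + 1)) * (s * ‖h‖) ≤ (-L h) / 2 * s := by
    rw [div_mul_eq_mul_div, div_le_iff₀ (by positivity)]
    have : 0 < -L h * s := mul_pos (by linarith) hs
    nlinarith
  nlinarith

/-- Submersion case: kernel directions are strongly tangent. -/
lemma STan_of_ker [FiniteDimensional ℝ E] {F : Type*} [NormedAddCommGroup F] [NormedSpace ℝ F]
    [CompleteSpace F]
    {C : Set (ℝ × E)} {z h : ℝ × E} {f : ℝ × E → F} {L : ℝ × E →L[ℝ] F}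
    (hf : HasStrictFDerivAt f L z)
    (hC : ∀ᶠ y in 𝓝 z, y ∈ C ↔ f y = 0)
    (hA : Function.Surjective (L.comp (ContinuousLinearMap.inr ℝ ℝ E))) (hh : L h = 0) :
    STan C z h := by
  haveI : CompleteSpace E := FiniteDimensional.complete ℝ E
  intro ε hε
  set A := L.comp (ContinuousLinearMap.inr ℝ ℝ E) with hAdef
  have hr : A.range = ⊤ := LinearMap.range_eq_top.2 hA
  set R := A.nonlinearRightInverseOfSurjective hr with hR
  have hN : 0 < (R.nnnorm : ℝ) := A.nonlinearRightInverseOfSurjective_nnnorm_pos hr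
  set N : ℝ := (R.nnnorm : ℝ) with hNdef
  set c : ℝ := N⁻¹ * ε / (‖h‖ + ε) with hc
  have hc0 : 0 < c := by rw [hc]; positivity
  have hceq : c * ‖h‖ = (N⁻¹ - c) * ε := by
    rw [hc]; field_simp; ring
  obtain ⟨ρ₁, hρ₁, H⟩ := strict_bound hf hc0
  obtain ⟨ρ₂, hρ₂, HC⟩ := Metric.eventually_nhds_iff.1 hC
  set ρ := min ρ₁ ρ₂ with hρdef
  have hρ : 0 < ρ := lt_min hρ₁ hρ₂
  set δ := ρ / (1 + ‖h‖ + ε) with hδdef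
  have hδ : 0 < δ := by rw [hδdef]; positivity
  have hδe : δ * (1 + ‖h‖ + ε) = ρ := by rw [hδdef]; field_simp
  refine ⟨δ, hδ, fun z' hz' hz'n s hs hsδ => ?_⟩
  have hδρ : δ ≤ ρ := by
    rw [← hδe]; nlinarith [norm_nonneg h]
  set t₁ := z'.1 + s * h.1 with ht₁
  set y₀ := z'.2 + s • h.2 with hy₀
  have hfz' : f z' = 0 := (HC (by
    rw [dist_eq_norm]; exact lt_of_lt_of_le hz'n (hδρ.trans (min_le_right _ _)))).1 hz'
  have hnear : ∀ y ∈ closedBall y₀ (ε * s), ‖((t₁, y) : ℝ × E) - z‖ < ρ := by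
    intro y hy
    rw [mem_closedBall, dist_eq_norm] at hy
    have e : ((t₁, y) : ℝ × E) - z = (z' - z) + s • h + (0, y - y₀) := by
      ext
      · simp [ht₁]; ring
      · simp [hy₀]; abel
    rw [e]
    have n1 : ‖((0, y - y₀) : ℝ × E)‖ ≤ ε * s := by
      rw [Prod.norm_def]; simp only [norm_zero]; exact max_le (by positivity) hy
    have n2 : ‖s • h‖ = s * ‖h‖ := by rw [norm_smul, Real.norm_of_nonneg hs.le]
    have n3 := norm_add₃_le (a := z' - z) (b := s • h) (c := ((0, y - y₀) : ℝ × E))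
    have : s * (‖h‖ + ε) ≤ δ * (‖h‖ + ε) := by gcongr
    nlinarith
  have happ : ApproximatesLinearOn (fun y : E => f (t₁, y)) A (closedBall y₀ (ε * s))
      ⟨c, hc0.le⟩ := by
    intro y hy y' hy'
    have h1 := H (t₁, y) ((hnear y hy).trans_le (min_le_left _ _)) (t₁, y')
      ((hnear y' hy').trans_le (min_le_left _ _))
    have e : ((t₁, y) : ℝ × E) - (t₁, y') = (0, y - y') := by ext <;> simp
    rw [e] at h1
    have e2 : ‖((0, y - y') : ℝ × E)‖ = ‖y - y'‖ := by simp [Prod.norm_def]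
    rw [e2] at h1
    change _ ≤ c * ‖y - y'‖
    simpa [hAdef] using h1
  have hsurj := happ.surjOn_closedBall_of_nonlinearRightInverse R (ε := ε * s) (b := y₀)
    (by positivity) le_rfl
  have h0 : (0 : F) ∈ closedBall (f (t₁, y₀)) ((N⁻¹ - c) * (ε * s)) := by
    rw [mem_closedBall, dist_zero_left]
    have h1 := H (t₁, y₀) ((hnear y₀ (mem_closedBall_self (by positivity))).trans_le
      (min_le_left _ _)) z' (hz'n.trans_le (hδρ.trans (min_le_left _ _)))
    have e : ((t₁, y₀) : ℝ × E) - z' = s • h := by ext <;> simp [ht₁, hy₀]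
    rw [e, hfz', map_smul, hh, norm_smul, Real.norm_of_nonneg hs.le] at h1
    simp only [smul_zero, sub_zero] at h1
    calc _ ≤ c * (s * ‖h‖) := h1
      _ = (c * ‖h‖) * s := by ring
      _ = _ := by rw [hceq]; ring
  obtain ⟨y, hy, hfy⟩ := hsurj h0
  refine ⟨y, ?_, ?_⟩
  · refine (HC ?_).2 hfy
    rw [dist_eq_norm]
    exact (hnear y hy).trans_le (min_le_right _ _)
  · rw [mem_closedBall, dist_eq_norm] at hy
    have : y - z'.2 - s • h.2 = y - y₀ := by rw [hy₀]; abel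
    rw [this]; exact hy

/-- Functionals vanishing on the kernel are Fréchet normals. -/
lemma frechet_of_ker {F : Type*} [NormedAddCommGroup F] [NormedSpace ℝ F]
    [FiniteDimensional ℝ F]
    {C : Set (ℝ × E)} {z v : ℝ × E} {f : ℝ × E → F} {L : ℝ × E →L[ℝ] F}
    (hf : HasStrictFDerivAt f L z) (hz : z ∈ C)
    (hC : ∀ᶠ y in 𝓝 z, y ∈ C ↔ f y = 0)
    (hL : Function.Surjective L) (hv : ∀ h, L h = 0 → pinner v h = 0) :
    v ∈ frechetNCP C z := by
  obtain ⟨R, hR⟩ := (L : ℝ × E →ₗ[ℝ] F).exists_rightInverse_of_surjective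
    (LinearMap.range_eq_top.2 hL)
  have hR' : ∀ p, L (R p) = p := fun p => by simpa using LinearMap.congr_fun hR p
  set R' : F →L[ℝ] ℝ := (plin v).comp (LinearMap.toContinuousLinearMap R) with hRd
  have hfac : ∀ h, pinner v h = R' (L h) := by
    intro h
    have h1 := hv (h - R (L h)) (by rw [map_sub, hR', sub_self])
    rw [← plin_apply, map_sub, sub_eq_zero] at h1
    rw [← plin_apply, h1]; rfl
  intro ε hε
  have hc : 0 < ε / (‖R'‖ + 1) := by positivity
  obtain ⟨ρ₁, hρ₁, H⟩ := strict_bound hf hc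
  obtain ⟨ρ₂, hρ₂, HC⟩ := Metric.eventually_nhds_iff.1 hC
  refine ⟨min ρ₁ ρ₂, lt_min hρ₁ hρ₂, fun y hy hyn => ?_⟩
  have hfz : f z = 0 := hC.self_of_nhds.1 hz
  have hfy : f y = 0 := (HC (by rw [dist_eq_norm]; exact hyn.trans_le (min_le_right _ _))).1 hy
  have h1 := H y (hyn.trans_le (min_le_left _ _)) z (by simpa using hρ₁)
  rw [hfz, hfy, sub_zero, zero_sub, norm_neg] at h1
  rw [hfac]
  calc R' (L (y - z)) ≤ ‖R' (L (y - z))‖ := le_abs_self _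
    _ ≤ ‖R'‖ * ‖L (y - z)‖ := R'.le_opNorm _
    _ ≤ (‖R'‖ + 1) * (ε / (‖R'‖ + 1) * ‖y - z‖) := by gcongr; linarith
    _ = ε * ‖y - z‖ := by field_simp

lemma case_submanifold [FiniteDimensional ℝ E] {F : Type*} [NormedAddCommGroup F]
    [NormedSpace ℝ F] [FiniteDimensional ℝ F] {S : ℝ → Set E} {t : ℝ} {x : E} (hx : x ∈ S t)
    (hfin : asymMod S t x < ⊤) {f : ℝ × E → F} {L : ℝ × E →L[ℝ] F}
    (hf : HasStrictFDerivAt f L (t, x))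
    (hC : ∀ᶠ y in 𝓝 (t, x), y ∈ sgraph S ↔ f y = 0)
    (hL : Function.Surjective L) :
    calmUp S t x = (asymMod S t x).toReal := by
  haveI : CompleteSpace F := FiniteDimensional.complete ℝ F
  have hz : (t, x) ∈ sgraph S := hx
  -- existence of a tangent vector with unit time component
  have hex : ∃ w₀ : E, L (1, w₀) = 0 := by
    by_contra! hno
    have : ((1 : ℝ), (0 : E)) ∈ frechetNCP (sgraph S) (t, x) := by
      refine frechet_of_ker hf hz hC hL fun h hh => ?_
      by_contra hne
      have h1 : h.1 ≠ 0 := by simpa [pinner] using hne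
      apply hno (h.1⁻¹ • h.2)
      have : ((1, h.1⁻¹ • h.2) : ℝ × E) = h.1⁻¹ • h := by ext <;> simp [h1]
      rw [this, map_smul, hh, smul_zero]
    have := time_le_zero hx hfin this
    linarith
  obtain ⟨w₀, hw₀⟩ := hex
  have hA : Function.Surjective (L.comp (ContinuousLinearMap.inr ℝ ℝ E)) := by
    intro p
    obtain ⟨q, hq⟩ := hL p
    refine ⟨q.2 - q.1 • w₀, ?_⟩
    have : ((0, q.2 - q.1 • w₀) : ℝ × E) = q - q.1 • (1, w₀) := by ext <;> simp
    simp only [ContinuousLinearMap.comp_apply, ContinuousLinearMap.inr_apply]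
    rw [this, map_sub, map_smul, hw₀, smul_zero, sub_zero, hq]
  have hT : ∀ h, L h = 0 → STan (sgraph S) (t, x) h := fun h hh => STan_of_ker hf hC hA hh
  refine main_reduction hx hfin ?_ ?_
  · intro v hv
    refine frechet_of_ker hf hz hC hL fun h hh => le_antisymm ((hT h hh).limiting_le hv) ?_
    have h1 := (hT (-h) (by rw [map_neg, hh, neg_zero])).limiting_le hv
    rw [← plin_apply, map_neg, plin_apply] at h1
    linarith
  · intro κ hκ
    let T₀ : Submodule ℝ E := (L.comp (ContinuousLinearMap.inr ℝ ℝ E)).ker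
    have hT₀ : ∀ e : E, e ∈ T₀ ↔ L (0, e) = 0 := fun e => by
      simp [T₀]
    obtain ⟨p, hp, w, hw, hpw⟩ := T₀.exists_add_mem_mem_orthogonal w₀
    have hLw : L (1, w) = 0 := by
      have : ((1, w) : ℝ × E) = (1, w₀) - (0, p) := by rw [hpw]; ext <;> simp
      rw [this, map_sub, hw₀, (hT₀ p).1 hp, sub_zero]
    refine ⟨w, ?_, hT _ hLw⟩
    refine lt_of_le_of_lt ?_ hκ
    by_cases hw0 : w = 0
    · simp [hw0]
    have hwn : 0 < ‖w‖ := norm_pos_iff.2 hw0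
    have hn : ((‖w‖ ^ 2, -w) : ℝ × E) ∈ frechetNCP (sgraph S) (t, x) := by
      refine frechet_of_ker hf hz hC hL fun h hh => ?_
      have hmem : h.2 - h.1 • w ∈ T₀ := by
        rw [hT₀]
        have : ((0, h.2 - h.1 • w) : ℝ × E) = h - h.1 • (1, w) := by ext <;> simp
        rw [this, map_sub, map_smul, hh, hLw, smul_zero, sub_zero]
      have h1 := (Submodule.mem_orthogonal' T₀ w).1 hw _ hmem
      rw [inner_sub_right, inner_smul_right, real_inner_self_eq_norm_sq] at h1
      simp only [pinner, inner_neg_left]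
      linarith
    have h2 := frechet_smul (r := ‖w‖⁻¹) (by positivity) hn
    have e : ‖w‖⁻¹ • ((‖w‖ ^ 2, -w) : ℝ × E) = (‖w‖, -(‖w‖⁻¹ • w)) := by
      ext <;> simp; field_simp
    rw [e] at h2
    exact le_asymMod_toReal hx hfin h2 (by rw [norm_smul]; simp [hwn.ne'])

lemma preconn_frontier {X : Type*} [TopologicalSpace X] {C D : Set X} (hD : IsPreconnected D)
    (hdis : ∀ p ∈ D, p ∉ frontier C) {p q : X} (hp : p ∈ D) (hq : q ∈ D) (hpC : p ∈ C) :
    q ∈ C := by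
  have hcov : D ⊆ interior C ∪ (closure C)ᶜ := by
    intro y hy
    have h1 := hdis y hy
    by_cases h2 : y ∈ closure C
    · left
      by_contra h3
      exact h1 ⟨h2, h3⟩
    · right; exact h2
  have hdj : Disjoint (interior C) (closure C)ᶜ :=
    Set.disjoint_left.2 fun y h1 h2 => h2 (subset_closure (interior_subset h1))
  rcases hD.subset_or_subset isOpen_interior isClosed_closure.isOpen_compl hdj hcov with h | h
  · exact interior_subset (h hq)
  · exact absurd (subset_closure hpC) (h hp)

/-- On the side `f < 0` membership in `C` is locally constant. -/
lemma side {P : Type*} [NormedAddCommGroup P] [NormedSpace ℝ P] {C : Set P}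
    {f : P → ℝ} {L : P →L[ℝ] ℝ} {z : P} (hf : HasStrictFDerivAt f L z) (hL : L ≠ 0)
    (hfz : f z = 0) (hcont : ∀ᶠ y in 𝓝 z, ContinuousAt f y)
    (hC : ∀ᶠ y in 𝓝 z, y ∈ frontier C → f y = 0) :
    ∃ b : Prop, ∀ᶠ p in 𝓝 z, f p < 0 → (p ∈ C ↔ b) := by
  obtain ⟨h, hh⟩ : ∃ h, L h < 0 := by
    by_contra! hno
    apply hL
    ext h
    have h1 := hno h
    have h2 := hno (-h)
    rw [map_neg] at h2
    simp; linarith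
  obtain ⟨δ, hδ, hdec⟩ := strict_decrease hf hh
  obtain ⟨ρ, hρ, HC⟩ := Metric.eventually_nhds_iff.1 (hC.and hcont)
  set r := min (δ / 2) (ρ / (2 * (‖h‖ + 1))) with hr
  have hr0 : 0 < r := by rw [hr]; positivity
  have hrδ : r < δ := lt_of_le_of_lt (min_le_left _ _) (by linarith)
  have hrρ : r * ‖h‖ < ρ / 2 + 0 * ρ := by
    have : r ≤ ρ / (2 * (‖h‖ + 1)) := min_le_right _ _
    rw [le_div_iff₀ (by positivity)] at this
    nlinarith [norm_nonneg h]
  have hnear : ∀ p, ‖p - z‖ < ρ / 2 → ∀ s, 0 ≤ s → s ≤ r → dist (p + s • h) z < ρ := by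
    intro p hp s hs hsr
    rw [dist_eq_norm]
    have e : p + s • h - z = (p - z) + s • h := by abel
    rw [e]
    refine (norm_add_le _ _).trans_lt ?_
    rw [norm_smul, Real.norm_of_nonneg hs]
    have : s * ‖h‖ ≤ r * ‖h‖ := by gcongr
    linarith
  have hneg : f (z + r • h) < 0 := by
    rw [← hfz]; exact hdec z (by simpa using hδ) r hr0 hrδ
  have hev : ∀ᶠ m in 𝓝 z, f (m + r • h) < 0 := by
    have hc : ContinuousAt f (z + r • h) :=
      (HC (hnear z (by simpa using half_pos hρ) r hr0.le le_rfl)).2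
    have hc' : ContinuousAt (fun m => f (m + r • h)) z :=
      ContinuousAt.comp (g := f) (f := fun m => m + r • h) hc (by fun_prop)
    exact hc'.eventually (gt_mem_nhds hneg)
  obtain ⟨η₁, hη₁, Hη⟩ := Metric.eventually_nhds_iff.1 hev
  set η := min η₁ (min δ (ρ / 2)) with hη
  have hη0 : 0 < η := by rw [hη]; positivity
  refine ⟨z + r • h ∈ C, ?_⟩
  filter_upwards [Metric.ball_mem_nhds z hη0] with p hp hfp
  have hpn : ‖p - z‖ < η := by simpa [dist_eq_norm] using hp
  -- the vertical segment
  set D₁ : Set P := (fun s : ℝ => p + s • h) '' Icc 0 r with hD₁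
  have hD₁c : IsPreconnected D₁ :=
    isPreconnected_Icc.image _ (by fun_prop)
  have hD₁f : ∀ q ∈ D₁, q ∉ frontier C := by
    rintro q ⟨s, hs, rfl⟩ hq
    have h0 := (HC (hnear p (hpn.trans_le ((min_le_right _ _).trans (min_le_right _ _)))
      s hs.1 hs.2)).1 hq
    have h0' : f (p + s • h) = 0 := h0
    rcases hs.1.eq_or_lt with h1 | h1
    · rw [← h1] at h0'; simp at h0'; linarith
    · have := hdec p (hpn.trans_le ((min_le_right _ _).trans (min_le_left _ _))) s h1
        (hs.2.trans_lt hrδ)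
      linarith
  have hp1 : p ∈ D₁ := ⟨0, ⟨le_rfl, hr0.le⟩, by simp⟩
  have hp2 : p + r • h ∈ D₁ := ⟨r, ⟨hr0.le, le_rfl⟩, rfl⟩
  -- the bottom disc
  set D₂ : Set P := (fun m : P => m + r • h) '' ball z η with hD₂
  have hD₂c : IsPreconnected D₂ :=
    (convex_ball z η).isPreconnected.image _ (by fun_prop)
  have hD₂f : ∀ q ∈ D₂, q ∉ frontier C := by
    rintro q ⟨m, hm, rfl⟩ hq
    have hmn : ‖m - z‖ < η := by simpa [dist_eq_norm] using hm
    have h0 : f (m + r • h) = 0 :=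
      (HC (hnear m (hmn.trans_le ((min_le_right _ _).trans (min_le_right _ _)))
      r hr0.le le_rfl)).1 hq
    have := Hη (lt_of_lt_of_le (mem_ball.1 hm) (min_le_left _ _))
    linarith
  have hz2 : z + r • h ∈ D₂ := ⟨z, mem_ball_self hη0, rfl⟩
  have hp3 : p + r • h ∈ D₂ := ⟨p, hp, rfl⟩
  constructor
  · intro hpC
    exact preconn_frontier hD₂c hD₂f hp3 hz2 (preconn_frontier hD₁c hD₁f hp1 hp2 hpC)
  · intro hzC
    exact preconn_frontier hD₁c hD₁f hp2 hp1 (preconn_frontier hD₂c hD₂f hz2 hp3 hzC)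

lemma local_sublevel {P : Type*} [NormedAddCommGroup P] [NormedSpace ℝ P] {C : Set P}
    (hcl : IsClosed C) (hreg : C = closure (interior C))
    {f : P → ℝ} {L : P →L[ℝ] ℝ} {z : P} (hz : z ∈ frontier C)
    (hf : HasStrictFDerivAt f L z) (hL : L ≠ 0)
    (hcont : ∀ᶠ y in 𝓝 z, ContinuousAt f y)
    (hC : ∀ᶠ y in 𝓝 z, y ∈ frontier C ↔ f y = 0) :
    (∀ᶠ y in 𝓝 z, y ∈ C ↔ f y ≤ 0) ∨ (∀ᶠ y in 𝓝 z, y ∈ C ↔ -f y ≤ 0) := by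
  have hfz : f z = 0 := hC.self_of_nhds.1 hz
  obtain ⟨b₁, hb₁⟩ := side (C := C) hf hL hfz hcont (hC.mono fun y h => h.1)
  obtain ⟨b₂, hb₂⟩ := side (C := C) (f := fun y => -f y) (L := -L) hf.neg (neg_ne_zero.2 hL)
    (by simp [hfz]) (hcont.mono fun y h => h.neg) (hC.mono fun y h hy => by simp [h.1 hy])
  have hfr : ∀ y, y ∈ frontier C → y ∈ C := fun y hy => hcl.frontier_subset hy
  by_cases h1 : b₁ <;> by_cases h2 : b₂
  · exfalso
    have : ∀ᶠ y in 𝓝 z, y ∈ C := by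
      filter_upwards [hC, hb₁, hb₂] with y h3 h4 h5
      rcases lt_trichotomy (f y) 0 with h | h | h
      · exact (h4 h).2 h1
      · exact hfr y (h3.2 h)
      · exact (h5 (by linarith)).2 h2
    exact hz.2 (mem_interior_iff_mem_nhds.2 this)
  · left
    filter_upwards [hC, hb₁, hb₂] with y h3 h4 h5
    rcases lt_trichotomy (f y) 0 with h | h | h
    · simp [h.le, (h4 h).2 h1]
    · simp [h, hfr y (h3.2 h)]
    · have : y ∉ C := fun hy => h2 ((h5 (by linarith)).1 hy)
      simp [this, h]
  · right
    filter_upwards [hC, hb₁, hb₂] with y h3 h4 h5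
    rcases lt_trichotomy (f y) 0 with h | h | h
    · have : y ∉ C := fun hy => h1 ((h4 h).1 hy)
      simp [this, h]
    · simp [h, hfr y (h3.2 h)]
    · simp [h.le, (h5 (by linarith)).2 h2]
  · exfalso
    have hzc : z ∈ closure (interior C) := hreg ▸ hfr z hz
    have hev : ∀ᶠ y in 𝓝 z, y ∉ interior C := by
      filter_upwards [hC, hb₁, hb₂] with y h3 h4 h5 hy
      rcases lt_trichotomy (f y) 0 with h | h | h
      · exact h1 ((h4 h).1 (interior_subset hy))
      · exact (h3.2 h).2 hy
      · exact h2 ((h5 (by linarith)).1 (interior_subset hy))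
    obtain ⟨y, hy1, hy2⟩ := mem_closure_iff_nhds.1 hzc _ hev
    exact hy1 hy2

lemma STan_of_neg {C : Set (ℝ × E)} {z h : ℝ × E} {f : ℝ × E → ℝ} {L : ℝ × E →L[ℝ] ℝ}
    (hf : HasStrictFDerivAt f L z) (hC : ∀ᶠ y in 𝓝 z, y ∈ C ↔ f y ≤ 0) (hh : L h < 0) :
    STan C z h := by
  intro ε hε
  obtain ⟨δ, hδ, hdec⟩ := strict_decrease hf hh
  obtain ⟨ρ, hρ, HC⟩ := Metric.eventually_nhds_iff.1 hC
  refine ⟨min δ (ρ / (1 + ‖h‖)), by positivity, fun z' hz' hz'n s hs hsδ => ?_⟩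
  have h1 : ‖z' - z‖ < ρ / (1 + ‖h‖) := hz'n.trans_le (min_le_right _ _)
  have h2 : s < ρ / (1 + ‖h‖) := hsδ.trans_le (min_le_right _ _)
  have e : ρ / (1 + ‖h‖) * (1 + ‖h‖) = ρ := by field_simp
  have hh0 := norm_nonneg h
  have hz'ρ : dist z' z < ρ := by
    rw [dist_eq_norm]
    have : 0 < ρ / (1 + ‖h‖) := by positivity
    nlinarith
  have hmem : z' + s • h ∈ C := by
    refine (HC ?_).2 ?_
    · rw [dist_eq_norm]
      have e' : z' + s • h - z = (z' - z) + s • h := by abel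
      rw [e']
      refine (norm_add_le _ _).trans_lt ?_
      rw [norm_smul, Real.norm_of_nonneg hs.le]
      nlinarith
    · exact (hdec z' (hz'n.trans_le (min_le_left _ _)) s hs (hsδ.trans_le (min_le_left _ _))).le.trans
        ((HC hz'ρ).1 hz')
  refine ⟨z'.2 + s • h.2, hmem, ?_⟩
  simp; positivity

lemma frechet_of_mul {C : Set (ℝ × E)} {z v : ℝ × E} {f : ℝ × E → ℝ} {L : ℝ × E →L[ℝ] ℝ}
    (hf : HasStrictFDerivAt f L z) (hC : ∀ᶠ y in 𝓝 z, y ∈ C ↔ f y ≤ 0) (hfz : f z = 0)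
    {l : ℝ} (hl : 0 ≤ l) (hv : ∀ h, pinner v h = l * L h) : v ∈ frechetNCP C z := by
  intro ε hε
  obtain ⟨ρ₁, hρ₁, H⟩ := strict_bound hf (c := ε / (l + 1)) (by positivity)
  obtain ⟨ρ₂, hρ₂, HC⟩ := Metric.eventually_nhds_iff.1 hC
  refine ⟨min ρ₁ ρ₂, lt_min hρ₁ hρ₂, fun y hy hyn => ?_⟩
  have hfy : f y ≤ 0 := (HC (by rw [dist_eq_norm]; exact hyn.trans_le (min_le_right _ _))).1 hy
  have h1 := H y (hyn.trans_le (min_le_left _ _)) z (by simpa using hρ₁)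
  have h2 := (neg_le_abs _).trans h1
  rw [hfz] at h2
  rw [hv]
  calc l * L (y - z) ≤ l * (ε / (l + 1) * ‖y - z‖) := by gcongr; linarith
    _ ≤ (l + 1) * (ε / (l + 1) * ‖y - z‖) := by gcongr; linarith
    _ = ε * ‖y - z‖ := by field_simp

lemma case_boundary [FiniteDimensional ℝ E] {S : ℝ → Set E} {t : ℝ} {x : E} (hx : x ∈ S t)
    (hfin : asymMod S t x < ⊤) {f : ℝ × E → ℝ} {L : ℝ × E →L[ℝ] ℝ}
    (hf : HasStrictFDerivAt f L (t, x)) (hL : L ≠ 0) (hfz : f (t, x) = 0)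
    (hC : ∀ᶠ y in 𝓝 (t, x), y ∈ sgraph S ↔ f y ≤ 0) :
    calmUp S t x = (asymMod S t x).toReal := by
  haveI : CompleteSpace E := FiniteDimensional.complete ℝ E
  have hT : ∀ h, L h < 0 → STan (sgraph S) (t, x) h := fun h hh => STan_of_neg hf hC hh
  obtain ⟨e, he⟩ : ∃ e, L e < 0 := by
    by_contra! hno
    apply hL
    apply ContinuousLinearMap.ext
    intro h
    have h1 := hno h
    have h2 := hno (-h)
    rw [map_neg] at h2
    simp only [ContinuousLinearMap.zero_apply]; linarith
  refine main_reduction hx hfin ?_ ?_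
  · intro v hv
    have hle : ∀ h, L h ≤ 0 → plin v h ≤ 0 := by
      intro h hh
      have key : ∀ r : ℝ, 0 < r → plin v (h + r • e) ≤ 0 := by
        intro r hr
        rw [plin_apply]
        refine (hT _ ?_).limiting_le hv
        rw [map_add, map_smul, smul_eq_mul]
        nlinarith
      have hc : Continuous fun r : ℝ => plin v (h + r • e) := by fun_prop
      have ht : Tendsto (fun r : ℝ => plin v (h + r • e)) (𝓝[>] 0) (𝓝 (plin v h)) := by
        have := (hc.tendsto 0).mono_left (nhdsWithin_le_nhds (s := Ioi 0))
        simpa using this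
      refine le_of_tendsto ht ?_
      filter_upwards [self_mem_nhdsWithin] with r hr
      exact key r hr
    refine frechet_of_mul hf hC hfz (l := plin v e / L e)
      (div_nonneg_of_nonpos (hle e he.le) he.le) fun h => ?_
    have h1 : L (h - (L h / L e) • e) = 0 := by
      rw [map_sub, map_smul, smul_eq_mul]; field_simp [he.ne]; ring
    have h2 := hle _ h1.le
    have h3 := hle (-(h - (L h / L e) • e)) (by rw [map_neg, h1, neg_zero])
    rw [map_neg] at h3
    rw [map_sub, map_smul, smul_eq_mul] at h2 h3
    rw [← plin_apply]
    have : plin v e / L e * L h = L h / L e * plin v e := by ring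
    rw [this]; linarith
  · intro κ hκ
    set α := L (1, 0) with hα
    set β : E := -((InnerProductSpace.toDual ℝ E).symm
      (L.comp (ContinuousLinearMap.inr ℝ ℝ E))) with hβ
    have hLe : ∀ h : ℝ × E, L h = α * h.1 - ⟪β, h.2⟫ := by
      intro h
      have e1 : h = h.1 • ((1, 0) : ℝ × E) + (0, h.2) := by ext <;> simp
      have e2 : ⟪β, h.2⟫ = -L (0, h.2) := by
        rw [hβ, inner_neg_left, InnerProductSpace.toDual_symm_apply]; simp
      rw [e2]
      conv_lhs => rw [e1, map_add, map_smul, smul_eq_mul]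
      ring
    have hn : (α, -β) ∈ frechetNCP (sgraph S) (t, x) := by
      refine frechet_of_mul hf hC hfz (l := 1) zero_le_one fun h => ?_
      rw [hLe]; simp [pinner, inner_neg_left]; ring
    have hA0 : 0 ≤ (asymMod S t x).toReal := ENNReal.toReal_nonneg
    by_cases hβ0 : β = 0
    · rw [hβ0, neg_zero] at hn
      have hα0 := time_le_zero hx hfin hn
      have hα1 : α ≠ 0 := by
        intro h0
        have := hLe e
        rw [hβ0, h0] at this
        simp at this; linarith
      refine ⟨0, by rw [norm_zero]; linarith, hT _ ?_⟩
      exact lt_of_le_of_ne hα0 hα1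
    · have hβn : 0 < ‖β‖ := norm_pos_iff.2 hβ0
      have h2 := frechet_smul (r := ‖β‖⁻¹) (by positivity) hn
      have e2 : ‖β‖⁻¹ • ((α, -β) : ℝ × E) = (‖β‖⁻¹ * α, -(‖β‖⁻¹ • β)) := by
        ext <;> simp
      rw [e2] at h2
      have h3 := le_asymMod_toReal hx hfin h2 (by rw [norm_smul]; simp [hβn.ne'])
      obtain ⟨κ', hκ1, hκ2⟩ := exists_between hκ
      have hκ0 : 0 ≤ κ' := by linarith
      refine ⟨(κ' * ‖β‖⁻¹) • β, ?_, hT _ ?_⟩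
      · rw [norm_smul, Real.norm_of_nonneg (by positivity)]
        have : κ' * ‖β‖⁻¹ * ‖β‖ = κ' := by field_simp
        rw [this]; exact hκ2
      · rw [hLe]
        simp only [inner_smul_right, real_inner_self_eq_norm_sq]
        have h4 : κ' * ‖β‖⁻¹ * ‖β‖ ^ 2 = κ' * ‖β‖ := by field_simp
        rw [h4]
        have h5 : ‖β‖⁻¹ * α < κ' := by linarith
        rw [inv_mul_lt_iff₀ hβn] at h5
        linarith

lemma case_interior {S : ℝ → Set E} {t : ℝ} {x : E} (hx : x ∈ S t)
    (hfin : asymMod S t x < ⊤) (hC : ∀ᶠ y in 𝓝 (t, x), y ∈ sgraph S) :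
    calmUp S t x = (asymMod S t x).toReal := by
  have hT : ∀ h, STan (sgraph S) (t, x) h := by
    intro h ε hε
    obtain ⟨ρ, hρ, HC⟩ := Metric.eventually_nhds_iff.1 hC
    refine ⟨ρ / (1 + ‖h‖), by positivity, fun z' hz' hz'n s hs hsδ => ?_⟩
    have e : ρ / (1 + ‖h‖) * (1 + ‖h‖) = ρ := by field_simp
    have hh0 := norm_nonneg h
    have hmem : z' + s • h ∈ sgraph S := by
      refine HC ?_
      rw [dist_eq_norm]
      have e' : z' + s • h - (t, x) = (z' - (t, x)) + s • h := by abel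
      rw [e']
      refine (norm_add_le _ _).trans_lt ?_
      rw [norm_smul, Real.norm_of_nonneg hs.le]
      nlinarith
    refine ⟨z'.2 + s • h.2, hmem, ?_⟩
    simp; positivity
  refine main_reduction hx hfin ?_ ?_
  · intro v hv
    have h1 := (hT v).limiting_le hv
    have h2 : pinner v v = v.1 ^ 2 + ‖v.2‖ ^ 2 := by
      rw [pinner, real_inner_self_eq_norm_sq]; ring
    rw [h2] at h1
    have h3 : v.1 = 0 := by nlinarith [sq_nonneg v.1, sq_nonneg ‖v.2‖]
    have h4 : v.2 = 0 := by
      rw [← norm_eq_zero]; nlinarith [sq_nonneg v.1, sq_nonneg ‖v.2‖]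
    intro ε hε
    refine ⟨1, one_pos, fun y _ _ => ?_⟩
    simp only [pinner, h3, h4, inner_zero_left, zero_mul, add_zero]
    positivity
  · intro κ hκ
    exact ⟨0, by rw [norm_zero]; exact lt_of_le_of_lt ENNReal.toReal_nonneg hκ, hT _⟩

/-- Local data extracted from the submanifold definition. -/
lemma submanifold_local {c : ℕ} {M : Set (ℝ × E)} (hM : IsC1SubmanifoldCodim c M) {z : ℝ × E}
    (hz : z ∈ M) : ∃ (f : ℝ × E → EuclideanSpace ℝ (Fin c))
      (L : ℝ × E →L[ℝ] EuclideanSpace ℝ (Fin c)), HasStrictFDerivAt f L z ∧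
      Function.Surjective L ∧ (∀ᶠ y in 𝓝 z, ContinuousAt f y) ∧
      ∀ᶠ y in 𝓝 z, y ∈ M ↔ f y = 0 := by
  obtain ⟨U, hU, hzU, f, hf, hs, hMU⟩ := hM z hz
  have hUn := hU.mem_nhds hzU
  refine ⟨f, fderiv ℝ f z, (hf.contDiffAt hUn).hasStrictFDerivAt one_ne_zero, ?_, ?_, ?_⟩
  · have := hs z hzU
    rwa [fderivWithin_of_isOpen hU hzU] at this
  · filter_upwards [hUn] with y hy
    exact (hf.contDiffAt (hU.mem_nhds hy)).continuousAt
  · filter_upwards [hUn] with y hy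
    have : y ∈ M ∩ U ↔ y ∈ {y ∈ U | f y = 0} := by rw [hMU]
    simpa [hy] using this

end Helpers

end Preliminaries
/-- Proposition: oriented calmness vs oriented modulus: for a smooth
sweeping process, `calm↑S(t,x) = ‖D*S(t,x)|⁺` whenever `‖D*S(t,x)|⁺ < +∞`. -/
theorem statement18 {E : Type*} [NormedAddCommGroup E] [InnerProductSpace ℝ E]
    [FiniteDimensional ℝ E] (S : ℝ → Set E) (hS : SmoothSweepingProcess S)
    (t : ℝ) (ht : t ∈ sdom S) (hsup : ∃ t' ∈ sdom S, t < t')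
    (x : E) (hx : x ∈ S t) (hfin : asymMod S t x < ⊤) :
    calmUp S t x = (asymMod S t x).toReal := by
  obtain ⟨hcl, -, ⟨c, -, hM⟩ | ⟨hreg, hM⟩⟩ := hS
  · obtain ⟨f, L, hf, hL, -, hC⟩ := submanifold_local hM (z := (t, x)) hx
    exact case_submanifold hx hfin hf hC hL
  · by_cases hz : (t, x) ∈ interior (sgraph S)
    · exact case_interior hx hfin (mem_interior_iff_mem_nhds.1 hz)
    · have hzf : (t, x) ∈ frontier (sgraph S) := ⟨subset_closure hx, hz⟩
      obtain ⟨f, L, hf, hL, hcont, hC⟩ := submanifold_local hM hzf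
      let π : EuclideanSpace ℝ (Fin 1) →L[ℝ] ℝ := EuclideanSpace.proj 0
      have hg : HasStrictFDerivAt (fun y => π (f y)) (π.comp L) (t, x) :=
        π.hasStrictFDerivAt.comp (t, x) hf
      have hπ : ∀ v, π v = 0 ↔ v = 0 := by
        intro v
        constructor
        · intro h
          ext i
          rw [Subsingleton.elim i 0]
          exact h
        · rintro rfl; simp
      have hL0 : π.comp L ≠ 0 := by
        intro h0
        obtain ⟨p, hp⟩ := hL (EuclideanSpace.single 0 1)
        have h1 : (π.comp L) p = 0 := by rw [h0]; rfl
        rw [ContinuousLinearMap.comp_apply, hp] at h1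
        simp [π] at h1
      have hcont' : ∀ᶠ y in 𝓝 (t, x), ContinuousAt (fun y => π (f y)) y :=
        hcont.mono fun y h => π.continuous.continuousAt.comp h
      have hC' : ∀ᶠ y in 𝓝 (t, x), y ∈ frontier (sgraph S) ↔ π (f y) = 0 :=
        hC.mono fun y h => h.trans (hπ _).symm
      have hfz : π (f (t, x)) = 0 := hC'.self_of_nhds.1 hzf
      rcases local_sublevel hcl hreg hzf hg hL0 hcont' hC' with h | h
      · exact case_boundary hx hfin hg hL0 hfz h
      · exact case_boundary hx hfin hg.neg (neg_ne_zero.2 hL0) (by simp [hfz]) h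
end

section
/- Let S : ℝ ⇒ ℝⁿ be a smooth sweeping process and [t₀,t₁] ⊂ dom(S). Then ex(S(t₀),S(t₁)) = sup_{x ∈ S(t₀)} d(x,S(t₁)) ≤ (sup_{t ∈ [t₀,t₁]} φ↑(t))·(t₁ − t₀), and moreover dist(S(t₀),S(t₁)) ≤ (sup_{t ∈ [t₀,t₁]} φ(t))·(t₁ − t₀), where dist denotes the Hausdorff–Pompeiu distance. -/
open Set Metric Filter MeasureTheory
open scoped ENNReal RealInnerProductSpace Topology Pointwise

section Helpers

variable {E : Type*} [NormedAddCommGroup E] [InnerProductSpace ℝ E]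

/-- A minimizer of `√(δ²+‖y-y₀‖²) - m t` on the graph near `z` yields a Fréchet normal. -/
lemma frechet_of_min (C : Set (ℝ × E)) (z : ℝ × E) (y₀ : E) (m d r : ℝ) (hd : 0 < d) (hr : 0 < r)
    (hmin : ∀ p ∈ C, ‖p - z‖ < r →
      Real.sqrt (d ^ 2 + ‖z.2 - y₀‖ ^ 2) - m * z.1 ≤ Real.sqrt (d ^ 2 + ‖p.2 - y₀‖ ^ 2) - m * p.1) :
    (m, -((Real.sqrt (d ^ 2 + ‖z.2 - y₀‖ ^ 2))⁻¹ • (z.2 - y₀))) ∈ frechetNCP C z := by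
  set A := Real.sqrt (d ^ 2 + ‖z.2 - y₀‖ ^ 2) with hA
  have hApos : 0 < A := Real.sqrt_pos.2 (by positivity)
  have hAsq : A ^ 2 = d ^ 2 + ‖z.2 - y₀‖ ^ 2 := Real.sq_sqrt (by positivity)
  intro ε hε
  refine ⟨min r (ε * A), lt_min hr (by positivity), fun p hp hpd => ?_⟩
  have h1 := hmin p hp (lt_of_lt_of_le hpd (min_le_left _ _))
  have h2 : ‖p - z‖ < ε * A := lt_of_lt_of_le hpd (min_le_right _ _)
  have hh : ‖p.2 - z.2‖ ≤ ‖p - z‖ := norm_snd_le (p - z)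
  have hexp : ‖p.2 - y₀‖ ^ 2 = ‖z.2 - y₀‖ ^ 2 + 2 * ⟪z.2 - y₀, p.2 - z.2⟫ + ‖p.2 - z.2‖ ^ 2 := by
    rw [← norm_add_sq_real]; congr 2; abel
  set i := ⟪z.2 - y₀, p.2 - z.2⟫ with hi
  set B := Real.sqrt (d ^ 2 + ‖p.2 - y₀‖ ^ 2) with hB
  have hBsq : B ^ 2 = d ^ 2 + ‖p.2 - y₀‖ ^ 2 := Real.sq_sqrt (by positivity)
  have h3 : A * (B - A) ≤ i + ‖p.2 - z.2‖ ^ 2 := by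
    nlinarith [sq_nonneg (B - A), sq_nonneg ‖p.2 - z.2‖]
  have h4 : ‖p.2 - z.2‖ ^ 2 ≤ ε * A * ‖p - z‖ := by
    nlinarith [norm_nonneg (p.2 - z.2), norm_nonneg (p - z)]
  have h5 : pinner (m, -(A⁻¹ • (z.2 - y₀))) (p - z) = m * (p.1 - z.1) - A⁻¹ * i := by
    simp only [pinner, Prod.fst_sub, Prod.snd_sub, inner_neg_left, real_inner_smul_left, hi]
    ring
  rw [h5]
  have h6 : A * (m * (p.1 - z.1) - A⁻¹ * i) ≤ A * (ε * ‖p - z‖) := by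
    have : A * (m * (p.1 - z.1) - A⁻¹ * i) = A * (m * (p.1 - z.1)) - i := by
      field_simp
    rw [this]
    have : A * (m * (p.1 - z.1)) ≤ A * (B - A) := mul_le_mul_of_nonneg_left (by linarith) hApos.le
    nlinarith
  exact le_of_mul_le_mul_left h6 hApos

/-- Local progress. -/
lemma local_progress [FiniteDimensional ℝ E] (S : ℝ → Set E) (hc : IsClosed (sgraph S))
    (t T : ℝ) (htT : t < T) (x : E) (hx : x ∈ S t) (M M' : ℝ) (hM : 0 ≤ M) (hMM : M < M')
    (hb : ∀ u : E, ‖u‖ ≤ 1 → ∀ a ∈ coderiv S t x u, a ≤ M) :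
    ∃ s y, t < s ∧ s ≤ T ∧ y ∈ S s ∧ ‖y - x‖ ≤ M' * (s - t) := by
  by_contra! hno
  obtain ⟨m, hm1, hm2⟩ := exists_between hMM
  set r := T - t with hr
  have hrpos : 0 < r := sub_pos.2 htT
  set z : ℝ × E := (t, x) with hz
  set K : Set (ℝ × E) := sgraph S ∩ closedBall z r with hK
  have hKc : IsCompact K := (isCompact_closedBall z r).inter_left hc
  have hzK : z ∈ K := ⟨hx, mem_closedBall_self hrpos.le⟩
  -- strict minimality
  have hstrict : ∀ p ∈ K, ‖p.2 - x‖ - m * (p.1 - t) ≤ 0 → p = z := by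
    rintro ⟨s, y⟩ ⟨hp, hpb⟩ hle
    simp only at hle
    have hp' : y ∈ S s := hp
    have hsT : s ≤ T := by
      have h1 : ‖(s, y) - z‖ ≤ r := by simpa [dist_eq_norm] using hpb
      have h2 : ‖s - t‖ ≤ r := (norm_fst_le ((s, y) - z)).trans h1
      have := (le_abs_self (s - t)).trans h2
      linarith
    rcases lt_trichotomy s t with h | h | h
    · nlinarith [norm_nonneg (y - x)]
    · subst h
      have : ‖y - x‖ ≤ 0 := by simpa using hle
      have : y = x := by
        have := norm_le_zero_iff.1 this
        exact sub_eq_zero.1 this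
      rw [this]
    · have := hno s y h hsT hp'
      nlinarith
  set d : ℕ → ℝ := fun n => 1 / ((n : ℝ) + 1) with hd
  have hdpos : ∀ n, 0 < d n := fun n => by positivity
  have hdlim : Tendsto d atTop (𝓝 0) := tendsto_one_div_add_atTop_nhds_zero_nat
  have hex : ∀ n, ∃ p ∈ K, ∀ q ∈ K,
      Real.sqrt (d n ^ 2 + ‖p.2 - x‖ ^ 2) - m * p.1 ≤
        Real.sqrt (d n ^ 2 + ‖q.2 - x‖ ^ 2) - m * q.1 := by
    intro n
    have hcont : Continuous (fun p : ℝ × E => Real.sqrt (d n ^ 2 + ‖p.2 - x‖ ^ 2) - m * p.1) := by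
      fun_prop
    obtain ⟨p, hp, hpm⟩ := hKc.exists_isMinOn ⟨z, hzK⟩ hcont.continuousOn
    exact ⟨p, hp, fun q hq => hpm hq⟩
  choose p hpK hpmin using hex
  set u : ℕ → E := fun n => (Real.sqrt (d n ^ 2 + ‖(p n).2 - x‖ ^ 2))⁻¹ • ((p n).2 - x) with hu
  have hle : ∀ n, ‖(p n).2 - x‖ ≤ Real.sqrt (d n ^ 2 + ‖(p n).2 - x‖ ^ 2) := fun n =>
    Real.le_sqrt_of_sq_le (by nlinarith [sq_nonneg (d n)])
  have hu1 : ∀ n, ‖u n‖ ≤ 1 := by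
    intro n
    have hpos : 0 < Real.sqrt (d n ^ 2 + ‖(p n).2 - x‖ ^ 2) :=
      Real.sqrt_pos.2 (by have := hdpos n; positivity)
    rw [hu]
    simp only [norm_smul, norm_inv, Real.norm_eq_abs, abs_of_pos hpos]
    rw [inv_mul_le_iff₀ hpos]
    simpa using hle n
  have hval : ∀ n, ‖(p n).2 - x‖ - m * ((p n).1 - t) ≤ d n := by
    intro n
    have h := hpmin n z hzK
    have h0 : Real.sqrt (d n ^ 2 + ‖z.2 - x‖ ^ 2) = d n := by
      simp [hz, Real.sqrt_sq (hdpos n).le]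
    rw [h0] at h
    have := hle n
    simp only [hz] at h
    linarith
  obtain ⟨⟨pl, ul⟩, hlK, φ, hφ, hlim⟩ :=
    (hKc.prod (isCompact_closedBall (0 : E) 1)).tendsto_subseq
      (x := fun n => (p n, u n)) (fun n => ⟨hpK n, by simpa using hu1 n⟩)
  have hpl : Tendsto (fun n => p (φ n)) atTop (𝓝 pl) := (Prod.tendsto_iff _ _).1 hlim |>.1
  have hul : Tendsto (fun n => u (φ n)) atTop (𝓝 ul) := (Prod.tendsto_iff _ _).1 hlim |>.2
  have hplz : pl = z := by
    apply hstrict pl hlK.1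
    have hcont : Continuous (fun p : ℝ × E => ‖p.2 - x‖ - m * (p.1 - t)) := by fun_prop
    exact le_of_tendsto_of_tendsto' ((hcont.tendsto pl).comp hpl)
      (hdlim.comp hφ.tendsto_atTop) (fun n => hval (φ n))
  subst hplz
  have hev : ∀ᶠ n in atTop, p (φ n) ∈ ball z r := hpl (ball_mem_nhds z hrpos)
  obtain ⟨N, hN⟩ := eventually_atTop.1 hev
  have hmem : m ∈ coderiv S t x ul := by
    refine ⟨fun n => p (φ (n + N)), fun n => (m, -u (φ (n + N))), fun n => (hpK _).1, fun n => ?_,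
      (tendsto_add_atTop_iff_nat N).2 hpl, ?_⟩
    · have hb := hN (n + N) (Nat.le_add_left _ _)
      refine frechet_of_min (sgraph S) _ x m _ (r - dist (p (φ (n + N))) z) (hdpos _)
        (sub_pos.2 hb) (fun q hq hqd => hpmin _ q ⟨hq, ?_⟩)
      rw [← dist_eq_norm] at hqd
      rw [mem_closedBall]
      have := dist_triangle q (p (φ (n + N))) z
      linarith
    · exact tendsto_const_nhds.prodMk_nhds
        (((tendsto_add_atTop_iff_nat (f := fun n => u (φ n)) N).2 hul).neg)
  have := hb ul (by simpa using hlK.2) m hmem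
  linarith

lemma global_reach [FiniteDimensional ℝ E] (S : ℝ → Set E) (hc : IsClosed (sgraph S))
    (t₀ t₁ : ℝ) (h01 : t₀ ≤ t₁) (M M' : ℝ) (hM : 0 ≤ M) (hMM : M < M')
    (hb : ∀ t ∈ Icc t₀ t₁, ∀ x ∈ S t, ∀ u : E, ‖u‖ ≤ 1 → ∀ a ∈ coderiv S t x u, a ≤ M)
    (x : E) (hx : x ∈ S t₀) : ∃ y ∈ S t₁, ‖y - x‖ ≤ M' * (t₁ - t₀) := by
  set K : Set (ℝ × E) := (sgraph S ∩ {p | ‖p.2 - x‖ ≤ M' * (p.1 - t₀)}) ∩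
    (Icc t₀ t₁ ×ˢ closedBall x (M' * (t₁ - t₀))) with hK
  have hcl : IsClosed {p : ℝ × E | ‖p.2 - x‖ ≤ M' * (p.1 - t₀)} :=
    isClosed_le (by fun_prop) (by fun_prop)
  have hKc : IsCompact K :=
    (isCompact_Icc.prod (isCompact_closedBall x (M' * (t₁ - t₀)))).inter_left (hc.inter hcl)
  have hM' : 0 < M' := lt_of_le_of_lt hM hMM
  have h0 : (t₀, x) ∈ K := by
    refine ⟨⟨hx, by simp⟩, ⟨le_refl _, h01⟩, mem_closedBall_self ?_⟩
    exact mul_nonneg hM'.le (sub_nonneg.2 h01)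
  obtain ⟨⟨s, y⟩, ⟨⟨hyS, hyb⟩, ⟨hs0, hs1⟩, -⟩, hmax⟩ :=
    hKc.exists_isMaxOn ⟨_, h0⟩ (continuous_fst.continuousOn)
  simp only [mem_setOf_eq] at hyb hs0 hs1
  rcases hs1.eq_or_lt with h | h
  · subst h
    exact ⟨y, hyS, hyb⟩
  · exfalso
    obtain ⟨s', y', h1, h2, h3, h4⟩ := local_progress S hc s t₁ h y hyS M M' hM hMM
      (hb s ⟨hs0, hs1⟩ y hyS)
    have h5 : ‖y' - x‖ ≤ M' * (s' - t₀) := by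
      have : ‖y' - x‖ ≤ ‖y' - y‖ + ‖y - x‖ := norm_sub_le_norm_sub_add_norm_sub _ _ _
      linarith
    have h6 : (s', y') ∈ K := by
      refine ⟨⟨h3, h5⟩, ⟨by simp only; linarith, h2⟩, ?_⟩
      rw [mem_closedBall, dist_eq_norm]
      refine h5.trans (mul_le_mul_of_nonneg_left (by linarith) hM'.le)
    have := hmax h6
    simp only [mem_setOf_eq] at this
    linarith

lemma infEdist_le_of_bound [FiniteDimensional ℝ E] (S : ℝ → Set E) (hc : IsClosed (sgraph S))
    (t₀ t₁ : ℝ) (h01 : t₀ ≤ t₁) (L : ℝ≥0∞)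
    (hb : ∀ t ∈ Icc t₀ t₁, ∀ x ∈ S t, ∀ u : E, ‖u‖ ≤ 1 → ∀ a ∈ coderiv S t x u,
      ENNReal.ofReal a ≤ L)
    (x : E) (hx : x ∈ S t₀) : EMetric.infEdist x (S t₁) ≤ L * ENNReal.ofReal (t₁ - t₀) := by
  rcases h01.eq_or_lt with h | h
  · subst h
    exact (Metric.infEDist_zero_of_mem hx).le.trans zero_le
  by_cases hL : L = ⊤
  · rw [hL, ENNReal.top_mul (by simpa using h)]
    exact le_top
  have hbR : ∀ t ∈ Icc t₀ t₁, ∀ x ∈ S t, ∀ u : E, ‖u‖ ≤ 1 → ∀ a ∈ coderiv S t x u,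
      a ≤ L.toReal := fun t ht x hx u hu a ha =>
    (ENNReal.ofReal_le_iff_le_toReal hL).1 (hb t ht x hx u hu a ha)
  have key : ∀ M' : ℝ, L.toReal < M' →
      EMetric.infEdist x (S t₁) ≤ ENNReal.ofReal (M' * (t₁ - t₀)) := by
    intro M' hM'
    obtain ⟨y, hy, hyx⟩ := global_reach S hc t₀ t₁ h01 L.toReal M' ENNReal.toReal_nonneg hM' hbR x hx
    refine (Metric.infEDist_le_edist_of_mem hy).trans ?_
    rw [edist_dist, dist_comm, dist_eq_norm]
    exact ENNReal.ofReal_le_ofReal hyx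
  have hlim : Tendsto (fun M' : ℝ => ENNReal.ofReal (M' * (t₁ - t₀))) (𝓝[>] L.toReal)
      (𝓝 (ENNReal.ofReal (L.toReal * (t₁ - t₀)))) := by
    apply Tendsto.mono_left _ nhdsWithin_le_nhds
    have : Continuous (fun M' : ℝ => ENNReal.ofReal (M' * (t₁ - t₀))) :=
      ENNReal.continuous_ofReal.comp (by fun_prop)
    exact this.tendsto _
  have := ge_of_tendsto hlim (eventually_nhdsWithin_of_forall (fun M' h => key M' h))
  rwa [ENNReal.ofReal_mul ENNReal.toReal_nonneg, ENNReal.ofReal_toReal hL] at this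

lemma norm_reflect (p q : ℝ × E) : ‖((-p.1, p.2) : ℝ × E) - (-q.1, q.2)‖ = ‖p - q‖ := by
  simp only [Prod.norm_def, Prod.fst_sub, Prod.snd_sub]
  rw [show -p.1 - -q.1 = -(p.1 - q.1) by ring, norm_neg]

lemma coderiv_reflect (S : ℝ → Set E) (t : ℝ) (x u : E) (a : ℝ)
    (h : a ∈ coderiv (fun s => S (-s)) t x u) : -a ∈ coderiv S (-t) x u := by
  obtain ⟨zs, vs, h1, h2, h3, h4⟩ := h
  have hcont : Continuous (fun p : ℝ × E => ((-p.1, p.2) : ℝ × E)) := by fun_prop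
  refine ⟨fun n => (-(zs n).1, (zs n).2), fun n => (-(vs n).1, (vs n).2), fun n => h1 n, fun n => ?_,
    (hcont.tendsto (t, x)).comp h3, (hcont.tendsto (a, -u)).comp h4⟩
  intro ε hε
  obtain ⟨δ, hδ, hh⟩ := h2 n ε hε
  refine ⟨δ, hδ, fun y hy hyd => ?_⟩
  have hn : ‖((-y.1, y.2) : ℝ × E) - zs n‖ = ‖y - (-(zs n).1, (zs n).2)‖ := by
    have := norm_reflect ((-y.1, y.2) : ℝ × E) (zs n)
    simpa using this.symm
  have := hh (-y.1, y.2) (by simpa [sgraph] using hy) (by rw [hn]; exact hyd)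
  rw [hn] at this
  refine le_trans (le_of_eq ?_) this
  simp only [pinner, Prod.fst_sub, Prod.snd_sub]
  ring

end Helpers

/-- Lemma: controlling the excess of `S(t₀)`: for a smooth sweeping
process and `[t₀,t₁] ⊂ dom S`, the excess `ex(S(t₀),S(t₁))` is bounded by
`(sup_{[t₀,t₁]} φ↑)·(t₁ - t₀)` and the Hausdorff–Pompeiu distance by
`(sup_{[t₀,t₁]} φ)·(t₁ - t₀)`. -/
theorem statement19 {E : Type*} [NormedAddCommGroup E] [InnerProductSpace ℝ E]
    [FiniteDimensional ℝ E] (S : ℝ → Set E) (hS : SmoothSweepingProcess S)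
    (t₀ t₁ : ℝ) (h01 : t₀ ≤ t₁) (hdom : Icc t₀ t₁ ⊆ sdom S) :
    (⨆ x ∈ S t₀, EMetric.infEdist x (S t₁)) ≤
      (⨆ t ∈ Icc t₀ t₁, orientedTalweg S t) * ENNReal.ofReal (t₁ - t₀) ∧
    EMetric.hausdorffEdist (S t₀) (S t₁) ≤
      (⨆ t ∈ Icc t₀ t₁, talweg S t) * ENNReal.ofReal (t₁ - t₀) := by
  have hc := hS.1
  have hfwd : ∀ x ∈ S t₀, EMetric.infEdist x (S t₁) ≤
      (⨆ t ∈ Icc t₀ t₁, orientedTalweg S t) * ENNReal.ofReal (t₁ - t₀) := by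
    refine infEdist_le_of_bound S hc t₀ t₁ h01 _ (fun t ht x hx u hu a ha => ?_)
    refine le_trans ?_ (le_iSup₂ (f := fun t (_ : t ∈ Icc t₀ t₁) => orientedTalweg S t) t ht)
    refine le_trans ?_ (le_iSup₂ (f := fun x (_ : x ∈ S t) => asymMod S t x) x hx)
    exact le_iSup₂_of_le u hu (le_iSup₂_of_le a ha le_rfl)
  have hsym : ∀ t ∈ Icc t₀ t₁, ∀ x ∈ S t, ∀ u : E, ‖u‖ ≤ 1 → ∀ a ∈ coderiv S t x u,
      ENNReal.ofReal |a| ≤ ⨆ t ∈ Icc t₀ t₁, talweg S t := by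
    intro t ht x hx u hu a ha
    refine le_trans ?_ (le_iSup₂ (f := fun t (_ : t ∈ Icc t₀ t₁) => talweg S t) t ht)
    refine le_trans ?_ (le_iSup₂ (f := fun x (_ : x ∈ S t) => symMod S t x) x hx)
    exact le_iSup₂_of_le u hu (le_iSup₂_of_le a ha le_rfl)
  refine ⟨iSup₂_le hfwd, Metric.hausdorffEDist_le_of_infEDist ?_ ?_⟩
  · exact infEdist_le_of_bound S hc t₀ t₁ h01 _ (fun t ht x hx u hu a ha =>
      (ENNReal.ofReal_le_ofReal (le_abs_self a)).trans (hsym t ht x hx u hu a ha))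
  · intro x hx
    have hc' : IsClosed (sgraph (fun s => S (-s))) :=
      hc.preimage (f := fun p : ℝ × E => ((-p.1, p.2) : ℝ × E)) (by fun_prop)
    have := infEdist_le_of_bound (fun s => S (-s)) hc' (-t₁) (-t₀) (by linarith)
      (⨆ t ∈ Icc t₀ t₁, talweg S t) (fun t ht x hx u hu a ha => by
        have h := hsym (-t) ⟨by linarith [ht.2], by linarith [ht.1]⟩ x hx u hu (-a)
          (coderiv_reflect S t x u a ha)
        rw [abs_neg] at h
        exact (ENNReal.ofReal_le_ofReal (le_abs_self a)).trans h) x (by simpa using hx)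
    simp only [neg_neg] at this
    rwa [show -t₀ - -t₁ = t₁ - t₀ by ring] at this
end
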